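/- Let Y be a real random variable with a continuous Lebesgue density p_Y satisfying 0 < p_Y(y) ≤ D < ∞ for all y ∈ ℝ, and let (X_n)_{n≥1} be real random variables with Lebesgue densities (p_n)_{n≥1} such that for some s > 1, sup_n E|ln p_Y(X_n)|^s < ∞. Assume moreover that either (i) there exists q with 2 < q ≤ ∞ such that sup_n ‖p_n − p_Y‖_q < ∞, or (ii) limsup_n ‖p_n‖_2 ≤ ‖p_Y‖_2 < ∞. Then the following are equivalent as n → ∞: (1) ‖p_n − p_Y‖_1 → 0; (2) ‖p_n − p_Y‖_2 → 0; (3) KL(X_n‖Y) → 0. -/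

import Mathlib

open MeasureTheory Real Filter
open scoped ENNReal

noncomputable section

/-- `p` is the Lebesgue density of the real random variable `X` defined on `(Ω, P)`. -/
def IsDensityOf {Ω : Type*} [MeasurableSpace Ω] (P : Measure Ω) (X : Ω → ℝ) (p : ℝ → ℝ) : Prop :=
  Measurable X ∧ Measurable p ∧ (∀ x, 0 ≤ p x) ∧
    Measure.map X P = volume.withDensity (fun x => ENNReal.ofReal (p x))

/-- Kullback–Leibler divergence between densities:  `∫ p_X ln (p_X / p_Y)`. -/
def KLdiv (pX pY : ℝ → ℝ) : ℝ := ∫ x, pX x * Real.log (pX x / pY x)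

theorem tendsto_zero_of_le_mul_add {a b : ℕ → ℝ} (hb : ∀ᶠ n in atTop, 0 ≤ b n)
    (ha : Tendsto a atTop (nhds 0))
    (h : ∀ η > 0, ∃ A, ∀ᶠ n in atTop, b n ≤ A * a n + η) :
    Tendsto b atTop (nhds 0) := by
  rw [Metric.tendsto_nhds]
  intro ε hε
  obtain ⟨A, hA⟩ := h (ε / 2) (by positivity)
  have h1 : Tendsto (fun n => A * a n) atTop (nhds 0) := by simpa using ha.const_mul A
  filter_upwards [hb, hA, h1.eventually_lt_const (half_pos hε)] with n h0 h2 h3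
  rw [Real.dist_eq, sub_zero, abs_of_nonneg h0]
  linarith

theorem eLpNorm_two_eq_ofReal_sqrt {f : ℝ → ℝ} (hf : MemLp f 2 volume) :
    eLpNorm f 2 volume = ENNReal.ofReal (√(∫ x, f x ^ 2)) := by
  rw [hf.eLpNorm_eq_integral_rpow_norm (by simp) (by simp), Real.sqrt_eq_rpow]
  simp

theorem tendsto_ofReal_zero_iff {a : ℕ → ℝ} (ha : ∀ n, 0 ≤ a n) :
    Tendsto (fun n => ENNReal.ofReal (a n)) atTop (nhds 0) ↔ Tendsto a atTop (nhds 0) := by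
  constructor
  · intro h
    simpa [Function.comp_def, ENNReal.toReal_ofReal (ha _)] using
      (ENNReal.tendsto_toReal ENNReal.zero_ne_top).comp h
  · intro h
    simpa using ENNReal.tendsto_ofReal h

theorem tendsto_eLpNorm_one_iff {f : ℕ → ℝ → ℝ} (hf : ∀ n, Integrable (f n)) :
    Tendsto (fun n => eLpNorm (f n) 1 volume) atTop (nhds 0) ↔
      Tendsto (fun n => ∫ x, |f n x|) atTop (nhds 0) := by
  rw [← tendsto_ofReal_zero_iff (fun n => integral_nonneg fun x => abs_nonneg _)]
  refine tendsto_congr fun n => ?_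
  rw [(memLp_one_iff_integrable.2 (hf n)).eLpNorm_eq_integral_rpow_norm (by simp) (by simp)]
  simp

theorem tendsto_eLpNorm_two_iff {f : ℕ → ℝ → ℝ} (hf : ∀ᶠ n in atTop, MemLp (f n) 2 volume) :
    Tendsto (fun n => eLpNorm (f n) 2 volume) atTop (nhds 0) ↔
      Tendsto (fun n => ∫ x, f n x ^ 2) atTop (nhds 0) := by
  have h0 : ∀ n, 0 ≤ ∫ x, f n x ^ 2 := fun n => integral_nonneg fun x => sq_nonneg _
  rw [tendsto_congr' (hf.mono fun n hn => eLpNorm_two_eq_ofReal_sqrt hn),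
    tendsto_ofReal_zero_iff fun n => Real.sqrt_nonneg _]
  constructor
  · intro h
    simpa [Real.sq_sqrt (h0 _)] using h.pow 2
  · intro h
    simpa using h.sqrt

theorem memLp_two_and_integral_sq_le {q K : ℝ≥0∞} (hq : 2 < q) (hK : K < ⊤) {η : ℝ}
    (hη : 0 < η) : ∃ A : ℝ, ∀ f : ℝ → ℝ, Integrable f → eLpNorm f q volume ≤ K →
      MemLp f 2 volume ∧ ∫ x, f x ^ 2 ≤ A * (∫ x, |f x|) + η := by
  have key : ∀ (A : ℝ) (f g : ℝ → ℝ), Integrable f → Integrable g → (∫ x, g x ≤ η) →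
      (∀ᵐ x, f x ^ 2 ≤ A * |f x| + g x) →
      MemLp f 2 volume ∧ ∫ x, f x ^ 2 ≤ A * (∫ x, |f x|) + η := by
    intro A f g hf hg hgη h
    have hi : Integrable (fun x => A * |f x| + g x) := (hf.abs.const_mul A).add hg
    have hsq : Integrable (fun x => f x ^ 2) := by
      refine hi.mono' (hf.aestronglyMeasurable.pow 2) ?_
      filter_upwards [h] with x hx
      rwa [Real.norm_eq_abs, abs_of_nonneg (sq_nonneg _)]
    refine ⟨(memLp_two_iff_integrable_sq hf.aestronglyMeasurable).2 hsq, ?_⟩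
    calc ∫ x, f x ^ 2 ≤ ∫ x, (A * |f x| + g x) := integral_mono_ae hsq hi h
      _ = A * (∫ x, |f x|) + ∫ x, g x := by
        rw [integral_add (hf.abs.const_mul A) hg, integral_const_mul]
      _ ≤ _ := by linarith
  rcases eq_or_ne q ⊤ with rfl | hqt
  · refine ⟨K.toReal, fun f hf hfK =>
      key _ f 0 hf (integrable_zero _ _ _) (by simpa using hη.le) ?_⟩
    rw [eLpNorm_exponent_top] at hfK
    filter_upwards [ae_le_eLpNormEssSup (f := f) (μ := volume)] with x hx
    have h1 : |f x| ≤ K.toReal := by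
      simpa using ENNReal.toReal_mono hK.ne (hx.trans hfK)
    have := mul_le_mul_of_nonneg_right h1 (abs_nonneg (f x))
    rw [← sq_abs]
    simp only [Pi.zero_apply]
    nlinarith
  · have hr : 2 < q.toReal := by
      simpa using (ENNReal.toReal_lt_toReal (by simp) hqt).2 hq
    set r := q.toReal
    have hlim : Tendsto (fun M : ℝ => M ^ (2 - r) * K.toReal ^ r) atTop (nhds 0) := by
      have := (tendsto_rpow_neg_atTop (y := r - 2) (by linarith)).mul_const (K.toReal ^ r)
      simpa using this
    obtain ⟨M, hM, hM0⟩ := ((hlim.eventually_lt_const hη).and (eventually_gt_atTop 0)).exists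
    refine ⟨M, fun f hf hfK => ?_⟩
    have hq0 : q ≠ 0 := (pos_of_gt hq).ne'
    have hmem : MemLp f q volume := ⟨hf.aestronglyMeasurable, hfK.trans_lt hK⟩
    have hint : Integrable (fun x => |f x| ^ r) := hmem.integrable_norm_rpow hq0 hqt
    have hI0 : 0 ≤ ∫ x, |f x| ^ r := integral_nonneg fun x => by positivity
    have hI : ∫ x, |f x| ^ r ≤ K.toReal ^ r := by
      rw [hmem.eLpNorm_eq_integral_rpow_norm hq0 hqt] at hfK
      have h2 := (ENNReal.ofReal_le_iff_le_toReal hK.ne).1 hfK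
      have h3 := Real.rpow_le_rpow (by positivity) h2 (show 0 ≤ r by linarith)
      rwa [Real.rpow_inv_rpow (by simpa using hI0) (by linarith)] at h3
    refine key M f _ hf (hint.const_mul (M ^ (2 - r))) ?_ (Eventually.of_forall fun x => ?_)
    · rw [integral_const_mul]
      have := mul_le_mul_of_nonneg_left hI (Real.rpow_nonneg hM0.le (2 - r))
      linarith
    · rw [← sq_abs]
      rcases le_or_gt |f x| M with h | h
      · have h1 : 0 ≤ M ^ (2 - r) * |f x| ^ r := by positivity
        nlinarith [abs_nonneg (f x)]
      · have hfx : 0 < |f x| := hM0.trans h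
        have h1 : |f x| ^ (2 - r) ≤ M ^ (2 - r) :=
          Real.rpow_le_rpow_of_nonpos hM0 h.le (by linarith)
        have h2 : |f x| ^ 2 = |f x| ^ (2 - r) * |f x| ^ r := by
          rw [← Real.rpow_add hfx, sub_add_cancel, Real.rpow_two]
        rw [h2]
        have h3 := mul_le_mul_of_nonneg_right h1 (Real.rpow_nonneg hfx.le r)
        have h4 : 0 ≤ M * |f x| := by positivity
        linarith

theorem sq_sub_sqrt_le_mul_log {p q : ℝ} (hp : 0 ≤ p) (hq : 0 < q) :
    (√p - √q) ^ 2 ≤ p * Real.log (p / q) - p + q := by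
  rcases hp.eq_or_lt with rfl | hp
  · simp [Real.sq_sqrt hq.le]
  have ha : 0 < √p := Real.sqrt_pos.2 hp
  have hb : 0 < √q := Real.sqrt_pos.2 hq
  have hpa : p = √p ^ 2 := (Real.sq_sqrt hp.le).symm
  have hqb : q = √q ^ 2 := (Real.sq_sqrt hq.le).symm
  have h1 : Real.log (p / q) = 2 * Real.log (√p / √q) := by
    rw [← Real.log_rpow (by positivity), Real.rpow_two, div_pow, ← hpa, ← hqb]
  have h2 := Real.one_sub_inv_le_log_of_pos (div_pos ha hb)
  have h3 := mul_le_mul_of_nonneg_left h2 (sq_nonneg √p)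
  have h4 : √p ^ 2 * (1 - (√p / √q)⁻¹) = √p ^ 2 - √p * √q := by
    field_simp
  rw [h4] at h3
  rw [h1]
  nlinarith

theorem abs_sub_le_mul_log {p q ε : ℝ} (hp : 0 ≤ p) (hq : 0 < q) (hε : 0 < ε) :
    |p - q| ≤ 1 / (2 * ε) * (p * Real.log (p / q) - p + q) + ε * (p + q) := by
  have h1 := mul_le_mul_of_nonneg_left (sq_sub_sqrt_le_mul_log hp hq)
    (show 0 ≤ 1 / (2 * ε) by positivity)
  have hpa : √p ^ 2 = p := Real.sq_sqrt hp
  have hqb : √q ^ 2 = q := Real.sq_sqrt hq.le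
  have h2 : |p - q| = |√p - √q| * (√p + √q) := by
    rw [← abs_of_nonneg (show 0 ≤ √p + √q by positivity), ← abs_mul]
    congr 1
    nlinarith
  have h3 : |√p - √q| * (√p + √q) ≤ 1 / (2 * ε) * (√p - √q) ^ 2 + ε / 2 * (√p + √q) ^ 2 := by
    rw [← sq_abs (√p - √q)]
    have h4 : 1 / (2 * ε) * |√p - √q| ^ 2 + ε / 2 * (√p + √q) ^ 2 - |√p - √q| * (√p + √q)
        = (|√p - √q| - ε * (√p + √q)) ^ 2 / (2 * ε) := by
      field_simp
      ring
    have h5 : 0 ≤ (|√p - √q| - ε * (√p + √q)) ^ 2 / (2 * ε) := by positivity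
    linarith
  have h6 : (√p + √q) ^ 2 ≤ 2 * (p + q) := by nlinarith [sq_nonneg (√p - √q)]
  nlinarith

theorem mul_log_le {p q δ s : ℝ} (hp : 0 ≤ p) (hq : 0 < q) (hδ : 0 < δ) (hδ1 : δ < 1)
    (hs : 1 < s) :
    p * Real.log (p / q) - p + q ≤ (1 / δ + 2) * (p - q) ^ 2 + |p - q| + 2 * δ * q
      + |Real.log δ| ^ (1 - s) * (p * |Real.log q| ^ s) := by
  have hlast : 0 ≤ |Real.log δ| ^ (1 - s) * (p * |Real.log q| ^ s) := by positivity
  have habs : q - p ≤ |p - q| := by rw [abs_sub_comm]; exact le_abs_self _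
  have hqδ : 0 < 2 * δ * q := by positivity
  rcases hp.eq_or_lt with rfl | hp
  · have : 0 ≤ (1 / δ + 2) * (0 - q) ^ 2 := by positivity
    simp only [zero_mul, mul_zero, zero_add, sub_zero] at *
    linarith
  rcases le_or_gt δ q with h | h
  · have h1 := mul_le_mul_of_nonneg_left (Real.log_le_sub_one_of_pos (div_pos hp hq)) hp.le
    have h2 : p * (p / q - 1) - p + q = 1 / q * (p - q) ^ 2 := by
      field_simp
      ring
    have h3 : 1 / q * (p - q) ^ 2 ≤ 1 / δ * (p - q) ^ 2 := by gcongr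
    nlinarith [sq_nonneg (p - q), abs_nonneg (p - q)]
  · have hlδ : 0 < |Real.log δ| := abs_pos.2 (Real.log_neg hδ hδ1).ne
    have hll : |Real.log δ| ≤ |Real.log q| := by
      rw [abs_of_neg (Real.log_neg hδ hδ1), abs_of_neg (Real.log_neg hq (h.trans hδ1))]
      exact neg_le_neg (Real.log_le_log hq h.le)
    have hlq := hlδ.trans_le hll
    have h1 : |Real.log q| ≤ |Real.log δ| ^ (1 - s) * |Real.log q| ^ s := by
      have h2 : |Real.log q| = |Real.log q| ^ (1 - s) * |Real.log q| ^ s := by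
        rw [← Real.rpow_add hlq, sub_add_cancel, Real.rpow_one]
      have h3 : |Real.log q| ^ (1 - s) ≤ |Real.log δ| ^ (1 - s) :=
        Real.rpow_le_rpow_of_nonpos hlδ hll (by linarith)
      calc |Real.log q| = |Real.log q| ^ (1 - s) * |Real.log q| ^ s := h2
        _ ≤ _ := by gcongr
    have h4 : Real.log (p / q) ≤ p + |Real.log q| := by
      rw [Real.log_div hp.ne' hq.ne']
      have := Real.log_le_sub_one_of_pos hp
      have := neg_abs_le (Real.log q)
      linarith
    have h5 := mul_le_mul_of_nonneg_left h4 hp.le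
    have h6 := mul_le_mul_of_nonneg_left h1 hp.le
    have h7 : 0 ≤ 1 / δ * (p - q) ^ 2 := by positivity
    have h8 : q * q ≤ δ * q := by gcongr
    nlinarith [sq_nonneg (p - 2 * q)]

theorem abs_sub_le_of_tail {p q δ η : ℝ} (hp : 0 ≤ p) (hq : 0 < q) (hδ : 0 < δ) (hη : 0 < η) :
    |p - q| ≤ (p - q) + 2 * (1 / (4 * η * δ) * (p - q) ^ 2 + η * q
      + {y : ℝ | y < δ}.indicator id q) := by
  have hsq : 0 ≤ 1 / (4 * η * δ) * (p - q) ^ 2 := by positivity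
  have hηq : 0 < η * q := by positivity
  have hind : 0 ≤ {y : ℝ | y < δ}.indicator id q := Set.indicator_apply_nonneg fun _ => hq.le
  rcases le_or_gt q p with h | h
  · rw [abs_of_nonneg (by linarith)]
    linarith
  rw [abs_of_neg (by linarith)]
  rcases lt_or_ge q δ with h1 | h1
  · rw [Set.indicator_of_mem (by exact h1)]
    simp only [id]
    linarith
  · have h4 : 1 / (4 * η * δ) * (p - q) ^ 2 + η * δ - (q - p)
        = (q - p - 2 * η * δ) ^ 2 / (4 * η * δ) := by
      field_simp
      ring
    have h5 : 0 ≤ (q - p - 2 * η * δ) ^ 2 / (4 * η * δ) := by positivity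
    have h6 : η * δ ≤ η * q := by gcongr
    linarith

theorem exists_integral_tail_le {q : ℝ → ℝ} (hq : Measurable q) (hpos : ∀ x, 0 < q x)
    (hi : Integrable q) {η : ℝ} (hη : 0 < η) :
    ∃ δ > 0, Integrable (fun x => {y : ℝ | y < δ}.indicator id (q x)) ∧
      ∫ x, {y : ℝ | y < δ}.indicator id (q x) ≤ η := by
  have hmeas : ∀ δ : ℝ, Measurable (fun x => {y : ℝ | y < δ}.indicator id (q x)) := fun δ =>
    (measurable_id.indicator measurableSet_Iio).comp hq
  have hle : ∀ (δ x : ℝ), ‖{y : ℝ | y < δ}.indicator id (q x)‖ ≤ q x := fun δ x => by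
    refine (norm_indicator_le_norm_self _ _).trans ?_
    simp [abs_of_pos (hpos x)]
  have hlim : Tendsto (fun n : ℕ => ∫ x, {y : ℝ | y < 1 / ((n : ℝ) + 1)}.indicator id (q x))
      atTop (nhds 0) := by
    rw [← integral_zero ℝ ℝ (μ := volume)]
    refine tendsto_integral_of_dominated_convergence q
      (fun n => (hmeas _).aestronglyMeasurable) hi
      (fun n => Eventually.of_forall fun x => hle _ x) (Eventually.of_forall fun x => ?_)
    refine tendsto_const_nhds.congr' ?_
    filter_upwards [tendsto_one_div_add_atTop_nhds_zero_nat.eventually_lt_const (hpos x)]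
      with n hn
    exact (Set.indicator_of_notMem (s := {y : ℝ | y < 1 / ((n : ℝ) + 1)})
      (fun h => (hn.trans h).false) (id : ℝ → ℝ)).symm
  obtain ⟨n, hn⟩ := (hlim.eventually_lt_const hη).exists
  exact ⟨1 / ((n : ℝ) + 1), by positivity,
    hi.mono' (hmeas _).aestronglyMeasurable (Eventually.of_forall fun x => hle _ x), hn.le⟩

namespace IsDensityOf

variable {Ω : Type*} [MeasurableSpace Ω] {P : Measure Ω} {X : Ω → ℝ} {p : ℝ → ℝ}

theorem integrable_mul (h : IsDensityOf P X p) {g : ℝ → ℝ} (hg : Measurable g)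
    (hi : Integrable (fun ω => g (X ω)) P) : Integrable (fun x => p x * g x) := by
  obtain ⟨hX, hp, h0, hmap⟩ := h
  have h1 : Integrable g (Measure.map X P) :=
    (integrable_map_measure hg.aestronglyMeasurable hX.aemeasurable).2 hi
  rw [hmap, integrable_withDensity_iff_integrable_smul' hp.ennreal_ofReal (by simp)] at h1
  simpa [ENNReal.toReal_ofReal (h0 _)] using h1

theorem integral_mul (h : IsDensityOf P X p) {g : ℝ → ℝ} (hg : Measurable g) :
    ∫ x, p x * g x = ∫ ω, g (X ω) ∂P := by
  obtain ⟨hX, hp, h0, hmap⟩ := h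
  rw [← integral_map hX.aemeasurable hg.aestronglyMeasurable, hmap,
    integral_withDensity_eq_integral_toReal_smul hp.ennreal_ofReal (by simp)]
  simp [ENNReal.toReal_ofReal (h0 _)]

theorem integrable [IsProbabilityMeasure P] (h : IsDensityOf P X p) : Integrable p := by
  simpa using h.integrable_mul (g := fun _ => 1) measurable_const (integrable_const _)

theorem integral_eq_one [IsProbabilityMeasure P] (h : IsDensityOf P X p) : ∫ x, p x = 1 := by
  simpa using h.integral_mul (g := fun _ => 1) measurable_const

end IsDensityOf

section Densities

variable {Ω : Type*} [MeasurableSpace Ω] {P : Measure Ω} [IsProbabilityMeasure P]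
  {X Y : Ω → ℝ} {p q : ℝ → ℝ}

theorem IsDensityOf.integrable_sub (hp : IsDensityOf P X p) (hq : IsDensityOf P Y q) :
    Integrable (fun x => p x - q x) :=
  hp.integrable.sub hq.integrable

theorem KLdiv_eq_integral (hp : IsDensityOf P X p) (hq : IsDensityOf P Y q)
    (hi : Integrable (fun x => p x * Real.log (p x / q x) - p x + q x)) :
    KLdiv p q = ∫ x, (p x * Real.log (p x / q x) - p x + q x) := by
  have h1 : Integrable (fun x => (p x * Real.log (p x / q x) - p x + q x) + (p x - q x)) :=
    hi.fun_add (hp.integrable_sub hq)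
  have h2 : KLdiv p q
      = ∫ x, ((p x * Real.log (p x / q x) - p x + q x) + (p x - q x)) := by
    unfold KLdiv
    congr 1 with x
    ring
  rw [h2, integral_add hi (hp.integrable_sub hq),
    integral_sub hp.integrable hq.integrable, hp.integral_eq_one, hq.integral_eq_one]
  ring

theorem integrable_and_KLdiv_le (hp : IsDensityOf P X p) (hq : IsDensityOf P Y q)
    (hpos : ∀ x, 0 < q x) (hmem : MemLp (fun x => p x - q x) 2 volume) {s C δ : ℝ} (hs : 1 < s)
    (hint : Integrable (fun ω => |Real.log (q (X ω))| ^ s) P)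
    (hC : ∫ ω, |Real.log (q (X ω))| ^ s ∂P ≤ C) (hδ : 0 < δ) (hδ1 : δ < 1) :
    Integrable (fun x => p x * Real.log (p x / q x) - p x + q x) ∧
      KLdiv p q ≤ (1 / δ + 2) * (∫ x, (p x - q x) ^ 2) + (∫ x, |p x - q x|)
        + (2 * δ + |Real.log δ| ^ (1 - s) * C) := by
  have hpm : Measurable p := hp.2.1
  have hqm : Measurable q := hq.2.1
  have hg : Measurable (fun x => |Real.log (q x)| ^ s) := by fun_prop
  have hsq := (hmem.integrable_sq).const_mul (1 / δ + 2)
  have habs := (hp.integrable_sub hq).abs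
  have hlin := hq.integrable.const_mul (2 * δ)
  have hmom := (hp.integrable_mul hg hint).const_mul (|Real.log δ| ^ (1 - s))
  have hbound := fun x => mul_log_le (hp.2.2.1 x) (hpos x) hδ hδ1 hs
  have hdom : Integrable (fun x => (1 / δ + 2) * (p x - q x) ^ 2 + |p x - q x| + 2 * δ * q x
      + |Real.log δ| ^ (1 - s) * (p x * |Real.log (q x)| ^ s)) :=
    ((hsq.fun_add habs).fun_add hlin).fun_add hmom
  have hi : Integrable (fun x => p x * Real.log (p x / q x) - p x + q x) := by
    refine hdom.mono' (by fun_prop) (Eventually.of_forall fun x => ?_)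
    rw [Real.norm_eq_abs, abs_of_nonneg
      ((sq_nonneg _).trans (sq_sub_sqrt_le_mul_log (hp.2.2.1 x) (hpos x)))]
    exact hbound x
  refine ⟨hi, ?_⟩
  rw [KLdiv_eq_integral hp hq hi]
  refine (integral_mono hi hdom hbound).trans ?_
  have hsum : ∫ x, ((1 / δ + 2) * (p x - q x) ^ 2 + |p x - q x| + 2 * δ * q x
      + |Real.log δ| ^ (1 - s) * (p x * |Real.log (q x)| ^ s))
      = (1 / δ + 2) * (∫ x, (p x - q x) ^ 2) + (∫ x, |p x - q x|) + 2 * δ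
        + |Real.log δ| ^ (1 - s) * ∫ ω, |Real.log (q (X ω))| ^ s ∂P := by
    rw [integral_add ((hsq.fun_add habs).fun_add hlin) hmom, integral_add (hsq.fun_add habs) hlin,
      integral_add hsq habs, integral_const_mul, integral_const_mul, integral_const_mul,
      hp.integral_mul hg, hq.integral_eq_one, mul_one]
  rw [hsum]
  have := mul_le_mul_of_nonneg_left hC (Real.rpow_nonneg (abs_nonneg (Real.log δ)) (1 - s))
  linarith

theorem integral_abs_sub_le_KLdiv (hp : IsDensityOf P X p) (hq : IsDensityOf P Y q)
    (hpos : ∀ x, 0 < q x)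
    (hi : Integrable (fun x => p x * Real.log (p x / q x) - p x + q x)) {ε : ℝ} (hε : 0 < ε) :
    ∫ x, |p x - q x| ≤ 1 / (2 * ε) * KLdiv p q + 2 * ε := by
  have h1 := hi.const_mul (1 / (2 * ε))
  have h2 := (hp.integrable.fun_add hq.integrable).const_mul ε
  calc ∫ x, |p x - q x|
      ≤ ∫ x, (1 / (2 * ε) * (p x * Real.log (p x / q x) - p x + q x) + ε * (p x + q x)) :=
        integral_mono (hp.integrable_sub hq).abs (h1.fun_add h2)
          fun x => abs_sub_le_mul_log (hp.2.2.1 x) (hpos x) hε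
    _ = _ := by
      rw [integral_add h1 h2, integral_const_mul, integral_const_mul,
        integral_add hp.integrable hq.integrable, hp.integral_eq_one, hq.integral_eq_one,
        KLdiv_eq_integral hp hq hi]
      ring

theorem KLdiv_nonneg (hp : IsDensityOf P X p) (hq : IsDensityOf P Y q) (hpos : ∀ x, 0 < q x)
    (hi : Integrable (fun x => p x * Real.log (p x / q x) - p x + q x)) : 0 ≤ KLdiv p q := by
  rw [KLdiv_eq_integral hp hq hi]
  exact integral_nonneg fun x =>
    (sq_nonneg _).trans (sq_sub_sqrt_le_mul_log (hp.2.2.1 x) (hpos x))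

/-- A quantitative Scheffé lemma: the `L¹` distance of `q` to any other density is controlled by
the `L²` distance. -/
theorem exists_integral_abs_sub_le (hq : IsDensityOf P Y q) (hpos : ∀ x, 0 < q x) {η : ℝ}
    (hη : 0 < η) : ∃ A : ℝ, ∀ (X : Ω → ℝ) (p : ℝ → ℝ), IsDensityOf P X p →
      MemLp (fun x => p x - q x) 2 volume →
      ∫ x, |p x - q x| ≤ A * (∫ x, (p x - q x) ^ 2) + η := by
  obtain ⟨δ, hδ, htail, htail_le⟩ :=
    exists_integral_tail_le hq.2.1 hpos hq.integrable (show 0 < η / 4 by positivity)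
  refine ⟨2 * (1 / (4 * (η / 4) * δ)), fun X p hp hmem => ?_⟩
  have h0 := hp.integrable_sub hq
  have h1 := hmem.integrable_sq.const_mul (1 / (4 * (η / 4) * δ))
  have h2 := hq.integrable.const_mul (η / 4)
  have h3 := ((h1.fun_add h2).fun_add htail).const_mul 2
  refine (integral_mono h0.abs (h0.fun_add h3)
    fun x => abs_sub_le_of_tail (hp.2.2.1 x) (hpos x) hδ (show 0 < η / 4 by positivity)).trans ?_
  rw [integral_add h0 h3, integral_const_mul, integral_add (h1.fun_add h2) htail,
    integral_add h1 h2, integral_const_mul, integral_const_mul,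
    integral_sub hp.integrable hq.integrable, hp.integral_eq_one, hq.integral_eq_one]
  linarith

theorem integral_sq_sub_le (hp : IsDensityOf P X p) (hq : IsDensityOf P Y q)
    (hq0 : ∀ x, 0 ≤ q x) {D : ℝ} (hbd : ∀ x, q x ≤ D)
    (hp2 : MemLp p 2 volume) (hq2 : MemLp q 2 volume) :
    ∫ x, (p x - q x) ^ 2
      ≤ 2 * D * (∫ x, |p x - q x|) + ((∫ x, p x ^ 2) - ∫ x, q x ^ 2) := by
  have h1 := (hp.integrable_sub hq).abs.const_mul (2 * D)
  have h2 : Integrable (fun x => p x ^ 2 - q x ^ 2) := hp2.integrable_sq.sub hq2.integrable_sq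
  rw [← integral_const_mul, ← integral_sub hp2.integrable_sq hq2.integrable_sq,
    ← integral_add h1 h2]
  refine integral_mono (hp2.sub hq2).integrable_sq (h1.fun_add h2) fun x => ?_
  have h3 : q x * (q x - p x) ≤ D * |p x - q x| := by
    rw [abs_sub_comm]
    exact (mul_le_mul_of_nonneg_left (le_abs_self _) (hq0 x)).trans
      (mul_le_mul_of_nonneg_right (hbd x) (abs_nonneg _))
  nlinarith

end Densities

theorem tendsto_two_mul_add_abs_log_rpow {s : ℝ} (hs : 1 < s) (C : ℝ) :
    Tendsto (fun δ : ℝ => 2 * δ + |Real.log δ| ^ (1 - s) * C) (nhdsWithin 0 (Set.Ioi 0))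
      (nhds 0) := by
  have h1 : Tendsto (fun δ : ℝ => 2 * δ) (nhdsWithin 0 (Set.Ioi 0)) (nhds 0) := by
    have : Tendsto (fun δ : ℝ => 2 * δ) (nhds 0) (nhds (2 * 0)) := tendsto_id.const_mul 2
    rw [mul_zero] at this
    exact this.mono_left nhdsWithin_le_nhds
  have h2 : Tendsto (fun δ : ℝ => |Real.log δ| ^ (1 - s)) (nhdsWithin 0 (Set.Ioi 0))
      (nhds 0) := by
    have := (tendsto_rpow_neg_atTop (y := s - 1) (by linarith)).comp
      (tendsto_abs_atBot_atTop.comp Real.tendsto_log_nhdsGT_zero)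
    simpa [Function.comp_def] using this
  simpa using h1.add (h2.mul_const C)

theorem eventually_memLp_and_integral_sq_le {p : ℕ → ℝ → ℝ} {q : ℝ → ℝ}
    (hp : ∀ n, AEStronglyMeasurable (p n)) (hq : MemLp q 2 volume)
    (hlim : limsup (fun n => eLpNorm (p n) 2 volume) atTop ≤ eLpNorm q 2 volume) {η : ℝ}
    (hη : 0 < η) :
    ∀ᶠ n in atTop, MemLp (p n) 2 volume ∧ (∫ x, p n x ^ 2) - (∫ x, q x ^ 2) ≤ η := by
  have hQ : 0 ≤ ∫ x, q x ^ 2 := integral_nonneg fun x => sq_nonneg _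
  have hlt : limsup (fun n => eLpNorm (p n) 2 volume) atTop
      < ENNReal.ofReal (√((∫ x, q x ^ 2) + η)) := by
    refine hlim.trans_lt ?_
    rw [eLpNorm_two_eq_ofReal_sqrt hq]
    exact (ENNReal.ofReal_lt_ofReal_iff (by positivity)).2 (Real.sqrt_lt_sqrt hQ (by linarith))
  filter_upwards [eventually_lt_of_limsup_lt hlt] with n hn
  have hmem : MemLp (p n) 2 volume := ⟨hp n, hn.trans ENNReal.ofReal_lt_top⟩
  refine ⟨hmem, ?_⟩
  rw [eLpNorm_two_eq_ofReal_sqrt hmem, ENNReal.ofReal_lt_ofReal_iff (by positivity)] at hn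
  have := (Real.sqrt_lt_sqrt_iff (integral_nonneg fun x => sq_nonneg _)).1 hn
  linarith

/-- **Corollary 2.2.** Let `Y` have a continuous, everywhere positive density `p_Y ≤ D`, and
let `X_n` have densities `p_n` with uniformly bounded moments `E|ln p_Y(X_n)|^s` for some
`s > 1`.  If either (i) `sup_n ‖p_n − p_Y‖_q < ∞` for some `2 < q ≤ ∞`, or
(ii) `limsup_n ‖p_n‖₂ ≤ ‖p_Y‖₂ < ∞`, then the following are equivalent:
(1) `‖p_n − p_Y‖₁ → 0`;  (2) `‖p_n − p_Y‖₂ → 0`;  (3) `KL(X_n‖Y) → 0`. -/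
theorem equivalence_L1_L2_KL
    {Ω : Type*} [MeasurableSpace Ω] (P : Measure Ω) [IsProbabilityMeasure P]
    (Y : Ω → ℝ) (pY : ℝ → ℝ) (hY : IsDensityOf P Y pY) (hcont : Continuous pY)
    (D : ℝ) (hpos : ∀ y, 0 < pY y) (hbd : ∀ y, pY y ≤ D)
    (X : ℕ → Ω → ℝ) (p : ℕ → ℝ → ℝ) (hX : ∀ n, IsDensityOf P (X n) (p n))
    (s : ℝ) (hs : 1 < s) (C : ℝ)
    (hint : ∀ n, Integrable (fun ω => |Real.log (pY (X n ω))| ^ s) P)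
    (hmom : ∀ n, ∫ ω, |Real.log (pY (X n ω))| ^ s ∂P ≤ C)
    (hcase :
      (∃ q : ℝ≥0∞, 2 < q ∧ ∃ K : ℝ≥0∞, K < ⊤ ∧
          ∀ n, eLpNorm (fun x => p n x - pY x) q volume ≤ K) ∨
      (Filter.limsup (fun n => eLpNorm (p n) 2 volume) atTop ≤ eLpNorm pY 2 volume ∧
          eLpNorm pY 2 volume < ⊤)) :
    (Tendsto (fun n => eLpNorm (fun x => p n x - pY x) 1 volume) atTop (nhds 0) ↔
      Tendsto (fun n => eLpNorm (fun x => p n x - pY x) 2 volume) atTop (nhds 0)) ∧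
    (Tendsto (fun n => eLpNorm (fun x => p n x - pY x) 2 volume) atTop (nhds 0) ↔
      Tendsto (fun n => KLdiv (p n) pY) atTop (nhds 0)) := by
  have hf : ∀ n, Integrable (fun x => p n x - pY x) := fun n =>
    (hX n).integrable_sub hY
  have hL1_L2 : (∀ᶠ n in atTop, MemLp (fun x => p n x - pY x) 2 volume) ∧
      ∀ η > 0, ∃ A, ∀ᶠ n in atTop,
        ∫ x, (p n x - pY x) ^ 2 ≤ A * (∫ x, |p n x - pY x|) + η := by
    rcases hcase with ⟨q, hq, K, hK, hqK⟩ | ⟨hlim, hfin⟩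
    · refine ⟨?_, fun η hη => ?_⟩
      · obtain ⟨A, hA⟩ := memLp_two_and_integral_sq_le hq hK one_pos
        exact Eventually.of_forall fun n => (hA _ (hf n) (hqK n)).1
      · obtain ⟨A, hA⟩ := memLp_two_and_integral_sq_le hq hK hη
        exact ⟨A, Eventually.of_forall fun n => (hA _ (hf n) (hqK n)).2⟩
    · have hY2 : MemLp pY 2 volume := ⟨hY.integrable.aestronglyMeasurable, hfin⟩
      have hev := fun η (hη : 0 < η) => eventually_memLp_and_integral_sq_le
        (fun n => (hX n).integrable.aestronglyMeasurable) hY2 hlim hη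
      refine ⟨(hev 1 one_pos).mono fun n hn => hn.1.sub hY2, fun η hη => ⟨2 * D, ?_⟩⟩
      filter_upwards [hev η hη] with n hn
      have := integral_sq_sub_le (hX n) hY (fun x => (hpos x).le) hbd hn.1 hY2
      linarith [hn.2]
  obtain ⟨hmem, hsq⟩ := hL1_L2
  rw [tendsto_eLpNorm_one_iff hf, tendsto_eLpNorm_two_iff hmem]
  have h12 : Tendsto (fun n => ∫ x, |p n x - pY x|) atTop (nhds 0) →
      Tendsto (fun n => ∫ x, (p n x - pY x) ^ 2) atTop (nhds 0) := fun h =>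
    tendsto_zero_of_le_mul_add
      (Eventually.of_forall fun n => integral_nonneg fun x => sq_nonneg _) h hsq
  have h21 : Tendsto (fun n => ∫ x, (p n x - pY x) ^ 2) atTop (nhds 0) →
      Tendsto (fun n => ∫ x, |p n x - pY x|) atTop (nhds 0) := fun h =>
    tendsto_zero_of_le_mul_add
      (Eventually.of_forall fun n => integral_nonneg fun x => abs_nonneg _) h fun η hη => by
        obtain ⟨A, hA⟩ := exists_integral_abs_sub_le hY hpos hη
        exact ⟨A, hmem.mono fun n hn => hA _ _ (hX n) hn⟩
  have hi : ∀ᶠ n in atTop,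
      Integrable (fun x => p n x * Real.log (p n x / pY x) - p n x + pY x) :=
    hmem.mono fun n hn => (integrable_and_KLdiv_le (hX n) hY hpos hn hs (hint n) (hmom n)
      one_half_pos one_half_lt_one).1
  refine ⟨⟨h12, h21⟩, fun h => ?_, fun h => h12 ?_⟩
  · have hsum : Tendsto (fun n => (∫ x, (p n x - pY x) ^ 2) + ∫ x, |p n x - pY x|) atTop
        (nhds 0) := by simpa using h.add (h21 h)
    refine tendsto_zero_of_le_mul_add (hi.mono fun n hn => KLdiv_nonneg (hX n) hY hpos hn) hsum
      fun η hη => ?_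
    obtain ⟨δ, ⟨hδη, hδ1⟩, hδ0⟩ :=
      (((tendsto_two_mul_add_abs_log_rpow hs C).eventually_lt_const hη).and
        (nhdsWithin_le_nhds (eventually_lt_nhds one_pos))).and self_mem_nhdsWithin |>.exists
    replace hδ0 : 0 < δ := hδ0
    refine ⟨1 / δ + 2, hmem.mono fun n hn => ?_⟩
    have hle := (integrable_and_KLdiv_le (hX n) hY hpos hn hs (hint n) (hmom n) hδ0 hδ1).2
    have habs : 0 ≤ ∫ x, |p n x - pY x| := integral_nonneg fun x => abs_nonneg _
    have hc : 1 ≤ 1 / δ + 2 := by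
      have : 0 < 1 / δ := by positivity
      linarith
    nlinarith
  · refine tendsto_zero_of_le_mul_add
      (Eventually.of_forall fun n => integral_nonneg fun x => abs_nonneg _) h fun η hη => ?_
    refine ⟨1 / (2 * (η / 2)), hi.mono fun n hn => ?_⟩
    have := integral_abs_sub_le_KLdiv (hX n) hY hpos hn (half_pos hη)
    linarith
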